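/- Let S be a multiplicative set of positive integers satisfying Condition B with density δ > 0 and exponent ρ > 0, and let γ_S be its Euler–Kronecker constant. Then the series Σ_{n=1}^∞ (δ − Λ_S(n))/n converges and γ_S = −δ·γ + Σ_{n=1}^∞ (δ − Λ_S(n))/n, where γ is the Euler–Mascheroni constant. -/

import Mathlib

open Filter Real
open scoped Classical

/-- A set of positive integers is *multiplicative* if `1 ∈ S` and for all coprime
positive integers `m, n` one has `m * n ∈ S ↔ m ∈ S ∧ n ∈ S`. -/
def IsMultiplicativeSet (S : Set ℕ) : Prop :=
  1 ∈ S ∧ ∀ m n : ℕ, 0 < m → 0 < n → Nat.Coprime m n → (m * n ∈ S ↔ m ∈ S ∧ n ∈ S)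

/-- `S(x)`: the number of `n ≤ x` with `n ∈ S`. -/
noncomputable def setCount (S : Set ℕ) (x : ℝ) : ℕ :=
  {n : ℕ | 0 < n ∧ (n : ℝ) ≤ x ∧ n ∈ S}.ncard

/-- `π_S(x)`: the number of primes `p ≤ x` with `p ∈ S`. -/
noncomputable def primeCount (S : Set ℕ) (x : ℝ) : ℕ :=
  {p : ℕ | p.Prime ∧ (p : ℝ) ≤ x ∧ p ∈ S}.ncard

/-- The characteristic function of `S`. -/
noncomputable def chiS (S : Set ℕ) (n : ℕ) : ℝ := if n ∈ S then 1 else 0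

/-- The logarithmic integral `Li(x) = ∫₂ˣ dt / log t`. -/
noncomputable def Li (x : ℝ) : ℝ := ∫ t in (2:ℝ)..x, 1 / Real.log t

/-- Condition B with density `δ` and exponent `ρ`:
`π_S(x) = δ Li(x) + O(x / (log x)^{2+ρ})`. -/
def ConditionB (S : Set ℕ) (δ ρ : ℝ) : Prop :=
  ∃ C : ℝ, ∀ x : ℝ, 2 ≤ x →
    |(primeCount S x : ℝ) - δ * Li x| ≤ C * x / Real.log x ^ (2 + ρ)

/-- The Dirichlet series `L_S(s) = ∑_{n ∈ S} n^{-s}` of `S` (as a function of a real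
variable `s`). -/
noncomputable def LSeries' (S : Set ℕ) (s : ℝ) : ℝ :=
  ∑' n : ℕ, if n ∈ S then (n : ℝ) ^ (-s) else 0

/-- `γS` is the Euler–Kronecker constant of `S` (with density `δ`), i.e.
`L_S'(s)/L_S(s) + δ/(s-1) → γS` as `s → 1⁺`. -/
def IsEulerKronecker (S : Set ℕ) (δ γS : ℝ) : Prop :=
  Tendsto (fun s : ℝ => deriv (LSeries' S) s / LSeries' S s + δ / (s - 1))
    (nhdsWithin 1 (Set.Ioi 1)) (nhds γS)

/-- The partial Euler-type product
`∏_{p < P, p prime} (1 + χ_S(p)/p + χ_S(p²)/p² + …) (1 - 1/p)^δ`. -/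
noncomputable def wirsingProd (S : Set ℕ) (δ : ℝ) (P : ℕ) : ℝ :=
  ∏ p ∈ Finset.filter Nat.Prime (Finset.range P),
    (∑' e : ℕ, chiS S (p ^ e) / (p : ℝ) ^ e) * (1 - 1 / (p : ℝ)) ^ δ

/-- `Λ_S` is the generalized von Mangoldt function of `S`: it vanishes outside prime
powers and satisfies `χ_S(n) log n = ∑_{d ∣ n} χ_S(n/d) Λ_S(d)` for all `n ≥ 1`. -/
def IsVonMangoldtOf (S : Set ℕ) (ΛS : ℕ → ℝ) : Prop :=
  (∀ n : ℕ, ¬ IsPrimePow n → ΛS n = 0) ∧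
  (∀ n : ℕ, 1 ≤ n →
    chiS S n * Real.log n = ∑ d ∈ n.divisors, chiS S (n / d) * ΛS d)

/-- Abel's theorem for Dirichlet series: a convergent series may be summed by inserting the
factors `(n + 1) ^ (-ε)` and letting `ε → 0⁺`. -/
lemma tendsto_tsum_mul_rpow_neg {a : ℕ → ℝ} {L : ℝ}
    (ha : Tendsto (fun N : ℕ => ∑ n ∈ Finset.range N, a n) atTop (nhds L))
    (hs : ∀ ε : ℝ, 0 < ε → Summable fun n : ℕ => a n * ((n : ℝ) + 1) ^ (-ε)) :
    Tendsto (fun ε : ℝ => ∑' n : ℕ, a n * ((n : ℝ) + 1) ^ (-ε))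
      (nhdsWithin 0 (Set.Ioi 0)) (nhds L) := by
  set B : ℕ → ℝ := fun N => ∑ n ∈ Finset.range N, a n - L with hBdef
  have hB : Tendsto B atTop (nhds 0) := by
    simpa [hBdef] using ha.sub_const L
  obtain ⟨M, hM⟩ : ∃ M : ℝ, ∀ n, |B n| ≤ M := by
    obtain ⟨M, hM⟩ := hB.abs.bddAbove_range
    exact ⟨M, fun n => hM ⟨n, rfl⟩⟩
  have hM0 : 0 ≤ M := (abs_nonneg _).trans (hM 0)
  have hkey : ∀ ε : ℝ, ∀ N : ℕ, ∑ n ∈ Finset.range N, a n * ((n : ℝ) + 1) ^ (-ε) - L =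
      B N * ((N : ℝ) + 1) ^ (-ε) + ∑ n ∈ Finset.range N,
        B (n + 1) * (((n : ℝ) + 1) ^ (-ε) - ((n : ℝ) + 1 + 1) ^ (-ε)) := by
    intro ε N
    induction N with
    | zero => simp [hBdef]
    | succ N ih =>
      have h1 : a N = B (N + 1) - B N := by simp [hBdef, Finset.sum_range_succ]
      rw [Finset.sum_range_succ, Finset.sum_range_succ, add_sub_right_comm, ih, h1]
      push_cast
      ring
  rw [Metric.tendsto_nhds]
  intro η hη
  obtain ⟨N₀, hN₀⟩ : ∃ N₀, ∀ n ≥ N₀, |B n| ≤ η / 4 := by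
    have := (Metric.tendsto_atTop.mp hB) (η / 4) (by positivity)
    obtain ⟨N₀, h⟩ := this
    exact ⟨N₀, fun n hn => by simpa using (h n hn).le⟩
  have hcont : Tendsto (fun ε : ℝ => M * (1 - ((N₀ : ℝ) + 1) ^ (-ε)))
      (nhdsWithin 0 (Set.Ioi 0)) (nhds 0) := by
    have h : Continuous fun ε : ℝ => M * (1 - ((N₀ : ℝ) + 1) ^ (-ε)) := by
      refine continuous_const.mul (continuous_const.sub ?_)
      exact Continuous.rpow continuous_const continuous_neg
        (fun x => Or.inl (by positivity))
    have := h.tendsto 0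
    simp only [neg_zero, Real.rpow_zero, sub_self, mul_zero] at this
    exact this.mono_left nhdsWithin_le_nhds
  have hev := hcont.eventually (gt_mem_nhds (show (0 : ℝ) < η / 4 by positivity))
  filter_upwards [hev, self_mem_nhdsWithin] with ε hε (hε0 : 0 < ε)
  have hwanti : ∀ x y : ℝ, 0 < x → x ≤ y → y ^ (-ε) ≤ x ^ (-ε) := fun x y hx hxy =>
    Real.rpow_le_rpow_of_nonpos hx hxy (by linarith)
  have hbound : ∀ N ≥ N₀, |∑ n ∈ Finset.range N, a n * ((n : ℝ) + 1) ^ (-ε) - L| ≤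
      3 * (η / 4) := by
    intro N hN
    rw [hkey]
    have hw1 : ((N : ℝ) + 1) ^ (-ε) ≤ 1 :=
      Real.rpow_le_one_of_one_le_of_nonpos (by linarith [N.cast_nonneg (α := ℝ)]) (by linarith)
    have hwN : 0 ≤ ((N : ℝ) + 1) ^ (-ε) := by positivity
    have h1 : |B N * ((N : ℝ) + 1) ^ (-ε)| ≤ η / 4 := by
      rw [abs_mul, abs_of_nonneg hwN]
      calc _ ≤ η / 4 * 1 := mul_le_mul (hN₀ N hN) hw1 hwN (by positivity)
        _ = _ := mul_one _
    have hd : ∀ n : ℕ, 0 ≤ ((n : ℝ) + 1) ^ (-ε) - ((n : ℝ) + 1 + 1) ^ (-ε) := fun n =>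
      sub_nonneg.mpr (hwanti _ _ (by positivity) (by linarith))
    have htel : ∀ K : ℕ, ∑ n ∈ Finset.range K,
        (((n : ℝ) + 1) ^ (-ε) - ((n : ℝ) + 1 + 1) ^ (-ε)) = 1 - ((K : ℝ) + 1) ^ (-ε) := by
      intro K
      have := Finset.sum_range_sub' (fun n : ℕ => ((n : ℝ) + 1) ^ (-ε)) K
      simpa using this
    have h2 : |∑ n ∈ Finset.range N,
        B (n + 1) * (((n : ℝ) + 1) ^ (-ε) - ((n : ℝ) + 1 + 1) ^ (-ε))| ≤
        M * (1 - ((N₀ : ℝ) + 1) ^ (-ε)) + η / 4 := by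
      rw [← Finset.sum_range_add_sum_Ico _ hN]
      refine (abs_add_le _ _).trans (add_le_add ?_ ?_)
      · rw [← htel, Finset.mul_sum]
        refine (Finset.abs_sum_le_sum_abs _ _).trans (Finset.sum_le_sum fun n _ => ?_)
        rw [abs_mul, abs_of_nonneg (hd n)]
        exact mul_le_mul_of_nonneg_right (hM _) (hd n)
      · calc _ ≤ ∑ n ∈ Finset.Ico N₀ N, η / 4 *
              (((n : ℝ) + 1) ^ (-ε) - ((n : ℝ) + 1 + 1) ^ (-ε)) := by
              refine (Finset.abs_sum_le_sum_abs _ _).trans (Finset.sum_le_sum fun n hn => ?_)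
              rw [abs_mul, abs_of_nonneg (hd n)]
              have := (Finset.mem_Ico.mp hn).1
              exact mul_le_mul_of_nonneg_right (hN₀ _ (by omega)) (hd n)
          _ ≤ ∑ n ∈ Finset.range N, η / 4 *
              (((n : ℝ) + 1) ^ (-ε) - ((n : ℝ) + 1 + 1) ^ (-ε)) := by
              refine Finset.sum_le_sum_of_subset_of_nonneg ?_
                fun n _ _ => mul_nonneg (by positivity) (hd n)
              rw [Finset.range_eq_Ico]
              exact Finset.Ico_subset_Ico_left (Nat.zero_le _)
          _ ≤ η / 4 := by
              rw [← Finset.mul_sum, htel]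
              nlinarith
    refine (abs_add_le _ _).trans ?_
    linarith
  have hlim := ((hs ε hε0).hasSum.tendsto_sum_nat.sub_const L).abs
  have : |∑' n : ℕ, a n * ((n : ℝ) + 1) ^ (-ε) - L| ≤ 3 * (η / 4) :=
    le_of_tendsto hlim (Filter.eventually_atTop.mpr ⟨N₀, hbound⟩)
  rw [Real.dist_eq]
  linarith

lemma summable_one_div_mul_log_rpow {ρ : ℝ} (hρ : 0 < ρ) :
    Summable fun n : ℕ => 1 / (((n : ℝ) + 2) * Real.log ((n : ℝ) + 2) ^ (1 + ρ)) := by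
  set f : ℕ → ℝ := fun n => 1 / ((n : ℝ) * Real.log ((n : ℝ) + 1) ^ (1 + ρ)) with hf
  have hlog : ∀ n : ℕ, 0 < n → 0 < Real.log ((n : ℝ) + 1) := fun n hn =>
    Real.log_pos (by have : (0 : ℝ) < n := by exact_mod_cast hn
                     linarith)
  have hfs : Summable f := by
    rw [← summable_condensed_iff_of_nonneg]
    · have h1 : Summable fun k : ℕ => (1 / Real.log 2 ^ (1 + ρ)) * (1 / (k : ℝ) ^ (1 + ρ)) :=
        (Real.summable_one_div_nat_rpow.mpr (by linarith)).mul_left _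
      rw [← summable_nat_add_iff 1] at h1 ⊢
      refine h1.of_nonneg_of_le (fun k => ?_) fun k => ?_
      · have := hlog (2 ^ (k + 1)) (by positivity)
        simp only [hf]
        positivity
      · have hl := hlog (2 ^ (k + 1)) (by positivity)
        have h2 : (0 : ℝ) < Real.log 2 := Real.log_pos (by norm_num)
        have hle : Real.log 2 * ((k + 1 : ℕ) : ℝ) ≤ Real.log (((2 ^ (k + 1) : ℕ) : ℝ) + 1) := by
          rw [mul_comm, ← Real.log_pow]
          refine Real.log_le_log (by positivity) ?_
          push_cast
          linarith
        have hpos : (0 : ℝ) < ((k + 1 : ℕ) : ℝ) := by positivity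
        rw [one_div_mul_one_div, ← Real.mul_rpow h2.le hpos.le]
        have hrp := Real.rpow_le_rpow (by positivity) hle (by linarith : 0 ≤ 1 + ρ)
        have hp0 : 0 < (Real.log 2 * ((k + 1 : ℕ) : ℝ)) ^ (1 + ρ) := by positivity
        simp only [hf]
        calc _ = 1 / Real.log (((2 ^ (k + 1) : ℕ) : ℝ) + 1) ^ (1 + ρ) := by
              push_cast
              field_simp
          _ ≤ _ := one_div_le_one_div_of_le hp0 hrp
    · intro n
      have : 0 ≤ Real.log ((n : ℝ) + 1) :=
        Real.log_nonneg (by linarith [n.cast_nonneg (α := ℝ)])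
      simp only [hf]
      positivity
    · intro m n hm hmn
      have hl := hlog m hm
      have hm' : (0 : ℝ) < m := by exact_mod_cast hm
      have hmn' : (m : ℝ) ≤ n := by exact_mod_cast hmn
      simp only [hf]
      gcongr
  rw [← summable_nat_add_iff 1] at hfs
  refine hfs.of_nonneg_of_le (fun n => ?_) fun n => ?_
  · have : 0 ≤ Real.log ((n : ℝ) + 2) :=
      Real.log_nonneg (by linarith [n.cast_nonneg (α := ℝ)])
    positivity
  · have hl := hlog (n + 1) (by positivity)
    push_cast at hl
    simp only [hf]
    push_cast
    rw [show (n : ℝ) + 1 + 1 = n + 2 by ring] at hl ⊢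
    gcongr
    linarith

/-- Growth of a logarithmic-derivative type recursion with coefficients in `[0, 1]`. -/
lemma abs_le_of_log_recursion {a l : ℕ → ℝ} (ha : ∀ n, 0 ≤ a n ∧ a n ≤ 1) (ha0 : a 0 = 1)
    (hl0 : l 0 = 0)
    (hrec : ∀ e : ℕ, e * a e = ∑ k ∈ Finset.range (e + 1), a (e - k) * l k) (e : ℕ) :
    |l e| ≤ 5 * (7 / 4) ^ e := by
  induction e using Nat.strong_induction_on with
  | _ e ih =>
    match e with
    | 0 => simp [hl0]
    | 1 =>
      have h := hrec 1
      simp [Finset.sum_range_succ, hl0, ha0] at h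
      rw [← h, abs_of_nonneg (ha 1).1]
      linarith [(ha 1).2]
    | e + 2 =>
      have h2 := hrec (e + 2)
      have h1 := hrec (e + 1)
      rw [Finset.sum_range_succ, Finset.sum_range_succ] at h2
      rw [Finset.sum_range_succ] at h1
      simp only [Nat.sub_self, ha0, one_mul] at h1 h2
      rw [show e + 2 - (e + 1) = 1 by omega] at h2
      have hl : l (e + 2) = (((e + 2 : ℕ) : ℝ) * a (e + 2) -
          a 1 * (((e + 1 : ℕ) : ℝ) * a (e + 1))) -
          ∑ k ∈ Finset.range (e + 1), (a (e + 2 - k) - a 1 * a (e + 1 - k)) * l k := by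
        simp only [sub_mul, Finset.sum_sub_distrib, mul_assoc, ← Finset.mul_sum]
        rw [h1, h2]
        ring
      have hb : |((e + 2 : ℕ) : ℝ) * a (e + 2) - a 1 * (((e + 1 : ℕ) : ℝ) * a (e + 1))| ≤
          e + 2 := by
        have hx : ((e + 2 : ℕ) : ℝ) * a (e + 2) ≤ e + 2 := by
          push_cast
          nlinarith [(ha (e + 2)).2, e.cast_nonneg (α := ℝ)]
        have hx0 : 0 ≤ ((e + 2 : ℕ) : ℝ) * a (e + 2) := mul_nonneg (by positivity) (ha _).1
        have hz0 : 0 ≤ ((e + 1 : ℕ) : ℝ) * a (e + 1) := mul_nonneg (by positivity) (ha _).1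
        have hz : ((e + 1 : ℕ) : ℝ) * a (e + 1) ≤ e + 2 := by
          push_cast
          nlinarith [(ha (e + 1)).2, e.cast_nonneg (α := ℝ)]
        have hy0 := mul_nonneg (ha 1).1 hz0
        have hy : a 1 * (((e + 1 : ℕ) : ℝ) * a (e + 1)) ≤ e + 2 := by
          nlinarith [(ha 1).2]
        exact abs_sub_le_iff.mpr ⟨by linarith, by linarith⟩
      have hs : |∑ k ∈ Finset.range (e + 1), (a (e + 2 - k) - a 1 * a (e + 1 - k)) * l k| ≤
          20 / 3 * ((7 / 4) ^ (e + 1) - 1) := by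
        calc _ ≤ ∑ k ∈ Finset.range (e + 1), 5 * (7 / 4 : ℝ) ^ k := by
              refine (Finset.abs_sum_le_sum_abs _ _).trans (Finset.sum_le_sum fun k hk => ?_)
              have hk' := Finset.mem_range.mp hk
              rw [abs_mul]
              have hc : |a (e + 2 - k) - a 1 * a (e + 1 - k)| ≤ 1 := by
                have h₁ := ha (e + 2 - k)
                have h₂ := mul_nonneg (ha 1).1 (ha (e + 1 - k)).1
                have h₃ := mul_le_one₀ (ha 1).2 (ha (e + 1 - k)).1 (ha (e + 1 - k)).2
                exact abs_sub_le_iff.mpr ⟨by linarith, by linarith⟩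
              calc _ ≤ 1 * |l k| := mul_le_mul_of_nonneg_right hc (abs_nonneg _)
                _ ≤ _ := by rw [one_mul]; exact ih k (by omega)
          _ = _ := by
              rw [← Finset.mul_sum, geom_sum_eq (by norm_num)]
              ring
      have hbern := one_add_mul_le_pow (show (-2 : ℝ) ≤ 3 / 4 by norm_num) e
      norm_num at hbern
      rw [hl]
      refine (abs_sub _ _).trans ?_
      rw [pow_succ] at hs
      rw [pow_add]
      nlinarith [e.cast_nonneg (α := ℝ)]

lemma primeCount_succ (S : Set ℕ) (n : ℕ) :
    (primeCount S ((n + 1 : ℕ) : ℝ) : ℝ) =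
      primeCount S (n : ℝ) + if (n + 1).Prime ∧ n + 1 ∈ S then 1 else 0 := by
  have hcard : ∀ n : ℕ, primeCount S (n : ℝ) =
      ∑ k ∈ Finset.range (n + 1), if k.Prime ∧ k ∈ S then 1 else 0 := by
    intro n
    rw [Finset.sum_boole, Nat.cast_id, primeCount, ← Set.ncard_coe_finset]
    congr 1
    ext k
    simp only [Nat.cast_le, Set.mem_ofPred_eq, Finset.coe_filter, Finset.mem_range]
    constructor
    · rintro ⟨h1, h2, h3⟩
      exact ⟨by omega, h1, h3⟩
    · rintro ⟨h1, h2, h3⟩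
      exact ⟨h2, by omega, h3⟩
  rw [hcard, hcard, Finset.sum_range_succ]
  push_cast
  rfl

lemma intervalIntegrable_one_div_log {x y : ℝ} (hx : 2 ≤ x) (hy : 2 ≤ y) :
    IntervalIntegrable (fun t : ℝ => 1 / Real.log t) MeasureTheory.volume x y := by
  refine ContinuousOn.intervalIntegrable fun t ht => ?_
  have ht2 : 2 ≤ t := (le_inf hx hy).trans ht.1
  have : Real.log t ≠ 0 := (Real.log_pos (by linarith)).ne'
  exact (continuousAt_const.div (Real.continuousAt_log (by linarith)) this).continuousWithinAt

lemma Li_add_one_sub_bounds {y : ℝ} (hy : 2 ≤ y) :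
    1 / Real.log (y + 1) ≤ Li (y + 1) - Li y ∧ Li (y + 1) - Li y ≤ 1 / Real.log y := by
  have h_int := intervalIntegrable_one_div_log hy (show 2 ≤ y + 1 by linarith)
  have hd : Li (y + 1) - Li y = ∫ t in y..(y + 1), 1 / Real.log t := by
    rw [Li, Li, intervalIntegral.integral_interval_sub_left
      (intervalIntegrable_one_div_log le_rfl (by linarith))
      (intervalIntegrable_one_div_log le_rfl hy)]
  rw [hd]
  constructor
  · have := intervalIntegral.integral_mono_on (by linarith) intervalIntegrable_const h_int
      (fun t ht => one_div_le_one_div_of_le (Real.log_pos (by linarith [ht.1]))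
        (Real.log_le_log (by linarith [ht.1]) ht.2) : ∀ t ∈ Set.Icc y (y + 1),
          1 / Real.log (y + 1) ≤ 1 / Real.log t)
    simpa using this
  · have := intervalIntegral.integral_mono_on (by linarith) h_int intervalIntegrable_const
      (fun t ht => one_div_le_one_div_of_le (Real.log_pos (by linarith))
        (Real.log_le_log (by linarith) ht.1) : ∀ t ∈ Set.Icc y (y + 1),
          1 / Real.log t ≤ 1 / Real.log y)
    simpa using this

lemma log_add_one_sub_log_le {y : ℝ} (hy : 0 < y) : Real.log (y + 1) - Real.log y ≤ 1 / y := by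
  rw [← Real.log_div (by linarith) hy.ne']
  refine (Real.log_le_sub_one_of_pos (by positivity)).trans_eq ?_
  field_simp
  ring

lemma abs_log_div_self_sub_le {y : ℝ} (hy : 2 ≤ y) :
    |Real.log (y + 1) / (y + 1) - Real.log y / y| ≤ 2 * Real.log y / y ^ 2 := by
  have h1 := log_add_one_sub_log_le (show 0 < y by linarith)
  have h2 : Real.log y ≤ Real.log (y + 1) := Real.log_le_log (by linarith) (by linarith)
  have h3 : (1 : ℝ) / 2 ≤ Real.log y :=
    (by linarith [Real.log_two_gt_d9] : (1 : ℝ) / 2 ≤ Real.log 2).trans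
      (Real.log_le_log (by norm_num) hy)
  have h4 : y * (Real.log (y + 1) - Real.log y) ≤ 1 := by
    calc _ ≤ y * (1 / y) := mul_le_mul_of_nonneg_left h1 (by linarith)
      _ = 1 := by field_simp
  have h5 : 0 ≤ y * (Real.log (y + 1) - Real.log y) :=
    mul_nonneg (by linarith) (by linarith)
  have he : Real.log (y + 1) / (y + 1) - Real.log y / y =
      (y * (Real.log (y + 1) - Real.log y) - Real.log y) / (y * (y + 1)) := by
    field_simp
    ring
  rw [he, abs_div, abs_of_pos (show 0 < y * (y + 1) by positivity)]
  refine div_le_div₀ (by linarith) (abs_le.mpr ⟨by linarith, by linarith⟩) (by positivity) ?_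
  nlinarith

/-- Under Condition B, the prime part of `∑ (δ - Λ_S(n)) / n` converges. -/
lemma ConditionB.exists_tendsto_sum_primes {S : Set ℕ} {δ ρ : ℝ} (hρ : 0 < ρ)
    (hB : ConditionB S δ ρ) :
    ∃ L : ℝ, Tendsto (fun N : ℕ => ∑ n ∈ Finset.range N,
      (δ - if (n + 1).Prime ∧ n + 1 ∈ S then Real.log ((n : ℝ) + 1) else 0) / ((n : ℝ) + 1))
      atTop (nhds L) := by
  obtain ⟨C, hC⟩ := hB
  set E : ℕ → ℝ := fun n => (primeCount S (n : ℝ) : ℝ) - δ * Li n with hE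
  set G : ℕ → ℝ := fun n => Real.log n / n with hG
  set I : ℕ → ℝ := fun m => Li ((m : ℝ) + 2 + 1) - Li ((m : ℝ) + 2) with hI
  set f : ℕ → ℝ := fun n =>
    (δ - if (n + 1).Prime ∧ n + 1 ∈ S then Real.log ((n : ℝ) + 1) else 0) / ((n : ℝ) + 1) with hf
  have hcast : ∀ m : ℕ, ((m + 2 : ℕ) : ℝ) = (m : ℝ) + 2 := fun m => by push_cast; ring
  have hcast' : ∀ m : ℕ, ((m + 2 + 1 : ℕ) : ℝ) = (m : ℝ) + 2 + 1 := fun m => by push_cast; ring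
  have hlog : ∀ m : ℕ, (1 : ℝ) / 2 ≤ Real.log ((m : ℝ) + 2) := fun m =>
    (by linarith [Real.log_two_gt_d9] : (1 : ℝ) / 2 ≤ Real.log 2).trans
      (Real.log_le_log (by norm_num) (by linarith [m.cast_nonneg (α := ℝ)]))
  have hterm : ∀ m : ℕ, f (m + 2) =
      δ * (1 / ((m : ℝ) + 2 + 1) - G (m + 2 + 1) * I m) -
        (E (m + 2 + 1) * G (m + 2 + 1) - E (m + 2) * G (m + 2)) +
        E (m + 2) * (G (m + 2 + 1) - G (m + 2)) := by
    intro m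
    have h := primeCount_succ S (m + 2)
    have hEd : E (m + 2 + 1) = E (m + 2) + (if (m + 2 + 1).Prime ∧ m + 2 + 1 ∈ S then 1 else 0)
        - δ * I m := by
      simp only [hE, hI, h]
      rw [hcast, hcast']
      ring
    rw [hEd]
    simp only [hf, hG]
    rw [hcast, hcast']
    split_ifs <;> field_simp <;> ring
  have hEb : ∀ m : ℕ, |E (m + 2)| ≤
      C * ((m : ℝ) + 2) / Real.log ((m : ℝ) + 2) ^ (2 + ρ) := by
    intro m
    have := hC ((m + 2 : ℕ) : ℝ) (by rw [hcast]; linarith [m.cast_nonneg (α := ℝ)])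
    simp only [hE]
    rwa [hcast] at this ⊢
  have hrpow : ∀ m : ℕ, Real.log ((m : ℝ) + 2) ^ (2 + ρ) =
      Real.log ((m : ℝ) + 2) ^ (1 + ρ) * Real.log ((m : ℝ) + 2) := by
    intro m
    rw [← Real.rpow_add_one (by linarith [hlog m])]
    ring_nf
  have hu : Summable fun m : ℕ => 1 / ((m : ℝ) + 2 + 1) - G (m + 2 + 1) * I m := by
    have hs : Summable fun m : ℕ => 2 * (1 / ((m : ℝ) + 2) ^ 2) := by
      have := ((Real.summable_one_div_nat_pow (p := 2)).mpr (by norm_num))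
      rw [← summable_nat_add_iff 2] at this
      simpa using this.mul_left 2
    refine Summable.of_norm_bounded hs fun m => ?_
    have hy : (2 : ℝ) ≤ (m : ℝ) + 2 := by linarith [m.cast_nonneg (α := ℝ)]
    obtain ⟨h1, h2⟩ := Li_add_one_sub_bounds hy
    have hl := hlog m
    have hd := log_add_one_sub_log_le (show (0 : ℝ) < (m : ℝ) + 2 by linarith)
    rw [Real.norm_eq_abs]
    simp only [hG, hI]
    rw [hcast']
    set y : ℝ := (m : ℝ) + 2
    set J : ℝ := Li (y + 1) - Li y
    have hl' : Real.log y ≤ Real.log (y + 1) := Real.log_le_log (by linarith) (by linarith)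
    have h1' : 1 ≤ Real.log (y + 1) * J := by
      rw [div_le_iff₀ (by linarith)] at h1
      linarith
    have h2' : Real.log (y + 1) * J ≤ 1 + 2 * (1 / y) := by
      calc _ ≤ Real.log (y + 1) * (1 / Real.log y) :=
            mul_le_mul_of_nonneg_left h2 (by linarith)
        _ ≤ 1 + 2 * (1 / y) := by
            rw [mul_one_div, div_le_iff₀ (by linarith)]
            have : 0 ≤ 1 / y := by positivity
            nlinarith
    have he : 1 / (y + 1) - Real.log (y + 1) / (y + 1) * J =
        -((Real.log (y + 1) * J - 1) / (y + 1)) := by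
      field_simp
      ring
    rw [he, abs_neg, abs_of_nonneg (div_nonneg (by linarith) (by linarith)),
      div_le_iff₀ (by linarith)]
    calc _ ≤ 2 * (1 / y) := by linarith
      _ = 2 * (1 / y ^ 2) * y := by field_simp
      _ ≤ _ := mul_le_mul_of_nonneg_left (by linarith) (by positivity)
  have hv : Summable fun m : ℕ => E (m + 2) * (G (m + 2 + 1) - G (m + 2)) := by
    refine Summable.of_norm_bounded ((summable_one_div_mul_log_rpow hρ).mul_left (2 * C))
      fun m => ?_
    have hy : (2 : ℝ) ≤ (m : ℝ) + 2 := by linarith [m.cast_nonneg (α := ℝ)]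
    have hg := abs_log_div_self_sub_le hy
    have hl := hlog m
    have hb := hEb m
    rw [hrpow] at hb
    rw [Real.norm_eq_abs, abs_mul]
    simp only [hG]
    rw [hcast', hcast]
    have hp : 0 < Real.log ((m : ℝ) + 2) ^ (1 + ρ) := Real.rpow_pos_of_pos (by linarith) _
    refine (mul_le_mul hb hg (abs_nonneg _) ((abs_nonneg _).trans hb)).trans_eq ?_
    have hl0 : Real.log ((m : ℝ) + 2) ≠ 0 := by linarith
    field_simp
  have hEG : Tendsto (fun m : ℕ => E (m + 2) * G (m + 2)) atTop (nhds 0) := by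
    have hlim : Tendsto (fun m : ℕ => C * (Real.log ((m : ℝ) + 2) ^ (1 + ρ))⁻¹) atTop
        (nhds 0) := by
      have h1 : Tendsto (fun m : ℕ => (m : ℝ) + 2) atTop atTop :=
        tendsto_atTop_add_const_right _ _ tendsto_natCast_atTop_atTop
      have h2 := (tendsto_rpow_atTop (show 0 < 1 + ρ by linarith)).comp
        (Real.tendsto_log_atTop.comp h1)
      simpa using (h2.inv_tendsto_atTop).const_mul C
    refine squeeze_zero_norm (fun m => ?_) hlim
    have hl := hlog m
    have hb := hEb m
    rw [hrpow] at hb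
    simp only [hG]
    rw [norm_mul, Real.norm_eq_abs, Real.norm_eq_abs, hcast,
      abs_of_nonneg (show 0 ≤ Real.log ((m : ℝ) + 2) / ((m : ℝ) + 2) by positivity)]
    have hp : 0 < Real.log ((m : ℝ) + 2) ^ (1 + ρ) := Real.rpow_pos_of_pos (by linarith) _
    refine (mul_le_mul_of_nonneg_right hb (by positivity)).trans_eq ?_
    have hl0 : Real.log ((m : ℝ) + 2) ≠ 0 := by linarith
    field_simp
  have htel : ∀ M : ℕ, ∑ m ∈ Finset.range M,
      (E (m + 2 + 1) * G (m + 2 + 1) - E (m + 2) * G (m + 2)) =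
      E (M + 2) * G (M + 2) - E 2 * G 2 := fun M => by
    have := Finset.sum_range_sub (fun m => E (m + 2) * G (m + 2)) M
    simp only [Nat.add_right_comm _ 1 2] at this
    simpa using this
  have hsum : ∀ M : ℕ, ∑ n ∈ Finset.range (M + 2), f n =
      δ * ∑ m ∈ Finset.range M, (1 / ((m : ℝ) + 2 + 1) - G (m + 2 + 1) * I m) -
        (E (M + 2) * G (M + 2) - E 2 * G 2) +
        ∑ m ∈ Finset.range M, E (m + 2) * (G (m + 2 + 1) - G (m + 2)) + (f 1 + f 0) := by
    intro M
    rw [Finset.sum_range_succ', Finset.sum_range_succ', ← htel, Finset.mul_sum,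
      ← Finset.sum_sub_distrib, ← Finset.sum_add_distrib, add_assoc]
    congr 1
    exact Finset.sum_congr rfl fun m _ => hterm m
  refine ⟨δ * (∑' m : ℕ, (1 / ((m : ℝ) + 2 + 1) - G (m + 2 + 1) * I m)) - (0 - E 2 * G 2) +
      (∑' m : ℕ, E (m + 2) * (G (m + 2 + 1) - G (m + 2))) + (f 1 + f 0),
    (tendsto_add_atTop_iff_nat 2).mp ?_⟩
  simp only [hsum]
  exact (((hu.hasSum.tendsto_sum_nat.const_mul δ).sub (hEG.sub_const _)).add
    hv.hasSum.tendsto_sum_nat).add_const _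

lemma chiS_mem_Icc (S : Set ℕ) (n : ℕ) : 0 ≤ chiS S n ∧ chiS S n ≤ 1 := by
  unfold chiS
  split_ifs <;> norm_num

lemma IsVonMangoldtOf.apply_one {S : Set ℕ} {ΛS : ℕ → ℝ} (hΛ : IsVonMangoldtOf S ΛS) :
    ΛS 1 = 0 := hΛ.1 1 not_isPrimePow_one

lemma IsVonMangoldtOf.apply_prime {S : Set ℕ} {ΛS : ℕ → ℝ} (hΛ : IsVonMangoldtOf S ΛS)
    (h1 : 1 ∈ S) {p : ℕ} (hp : p.Prime) : ΛS p = chiS S p * Real.log p := by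
  have h := hΛ.2 p hp.one_le
  rw [Nat.Prime.sum_divisors hp, Nat.div_self hp.pos, hΛ.apply_one] at h
  simpa [chiS, h1] using h.symm

lemma IsVonMangoldtOf.abs_apply_prime_pow_le {S : Set ℕ} {ΛS : ℕ → ℝ}
    (hΛ : IsVonMangoldtOf S ΛS) (h1 : 1 ∈ S) {p : ℕ} (hp : p.Prime) (e : ℕ) :
    |ΛS (p ^ e)| ≤ 5 * (7 / 4) ^ e * Real.log p := by
  have hlog : 0 < Real.log p := Real.log_pos (by exact_mod_cast hp.one_lt)
  have h := abs_le_of_log_recursion (a := fun e => chiS S (p ^ e))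
    (l := fun e => ΛS (p ^ e) / Real.log p) (fun n => chiS_mem_Icc _ _) (by simp [chiS, h1])
    (by simp [hΛ.apply_one]) (fun e => by
      have h := hΛ.2 (p ^ e) (Nat.one_le_pow _ _ hp.pos)
      rw [Nat.sum_divisors_prime_pow hp] at h
      push_cast at h
      rw [Real.log_pow] at h
      have h' : (e : ℝ) * chiS S (p ^ e) = (∑ k ∈ Finset.range (e + 1),
          chiS S (p ^ e / p ^ k) * ΛS (p ^ k)) / Real.log p := by
        rw [← h]
        field_simp
      rw [h', Finset.sum_div]
      refine Finset.sum_congr rfl fun k hk => ?_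
      rw [Nat.pow_div (by have := Finset.mem_range.mp hk; omega) hp.pos, mul_div_assoc]) e
  rwa [abs_div, abs_of_pos hlog, div_le_iff₀ hlog] at h

/-- The contribution of proper prime powers to `∑ Λ_S(n) / n` converges absolutely. -/
lemma IsVonMangoldtOf.summable_sub_prime_div {S : Set ℕ} {ΛS : ℕ → ℝ}
    (hΛ : IsVonMangoldtOf S ΛS) (h1 : 1 ∈ S) :
    Summable fun n : ℕ => (ΛS n - if n.Prime ∧ n ∈ S then Real.log n else 0) / n := by
  set F : ℕ → ℝ := fun n => (ΛS n - if n.Prime ∧ n ∈ S then Real.log n else 0) / n with hF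
  have hF0 : ∀ n, n ∉ Set.range (Subtype.val : {n : ℕ // IsPrimePow n} → ℕ) → F n = 0 := by
    intro n hn
    have hn' : ¬ IsPrimePow n := fun h => hn ⟨⟨n, h⟩, rfl⟩
    have hnp : ¬ n.Prime := fun h => hn' h.isPrimePow
    simp [hF, hΛ.1 n hn', hnp]
  rw [← Function.Injective.summable_iff Subtype.val_injective hF0,
    ← Nat.Primes.prodNatEquiv.summable_iff]
  have hsp : Summable fun p : Nat.Primes => Real.log (p : ℕ) / ((p : ℕ) : ℝ) ^ 2 := by
    have hs : Summable fun n : ℕ => 2 * (1 / (n : ℝ) ^ (3 / 2 : ℝ)) :=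
      (Real.summable_one_div_nat_rpow.mpr (by norm_num)).mul_left 2
    refine Summable.of_nonneg_of_le (fun p => ?_) (fun p => ?_)
      (hs.comp_injective (i := fun p : Nat.Primes => (p : ℕ)) Subtype.val_injective)
    · have := Real.log_nonneg (by exact_mod_cast p.2.one_le : (1 : ℝ) ≤ (p : ℕ))
      positivity
    · have hp : (0 : ℝ) < (p : ℕ) := by exact_mod_cast p.2.pos
      have hl := Real.log_le_rpow_div hp.le (show (0 : ℝ) < 1 / 2 by norm_num)
      simp only [Function.comp_apply]
      calc _ ≤ ((p : ℕ) : ℝ) ^ (1 / 2 : ℝ) / (1 / 2) / ((p : ℕ) : ℝ) ^ 2 := by gcongr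
        _ = 2 * (((p : ℕ) : ℝ) ^ (1 / 2 : ℝ) / ((p : ℕ) : ℝ) ^ (2 : ℝ)) := by
            rw [Real.rpow_two]
            ring
        _ = _ := by
            rw [← Real.rpow_sub hp, one_div (_ ^ (3 / 2 : ℝ)), ← Real.rpow_neg hp.le]
            norm_num
  have hsk : Summable fun k : ℕ => (7 / 8 : ℝ) ^ k :=
    summable_geometric_of_lt_one (by norm_num) (by norm_num)
  have hb := (hsp.mul_of_nonneg hsk
    (fun p => div_nonneg (Real.log_natCast_nonneg _) (by positivity))
    fun k => by positivity).mul_left (5 * (7 / 4) ^ 2 * (8 / 7))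
  refine Summable.of_norm_bounded hb ?_
  rintro ⟨p, k⟩
  have hp : (2 : ℝ) ≤ (p : ℕ) := by exact_mod_cast p.2.two_le
  have hl : 0 ≤ Real.log (p : ℕ) := Real.log_natCast_nonneg _
  simp only [Function.comp_apply, Nat.Primes.prodNatEquiv_apply]
  rcases k with _ | k
  · have : F (p : ℕ) = 0 := by
      simp only [hF]
      rw [hΛ.apply_prime h1 p.2]
      simp [chiS, p.2]
    simp only [zero_add, pow_one, this, norm_zero]
    positivity
  · have hnp : ¬ ((p : ℕ) ^ (k + 1 + 1)).Prime := Nat.Prime.not_prime_pow (by omega)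
    have hbd := hΛ.abs_apply_prime_pow_le h1 p.2 (k + 1 + 1)
    simp only [hF, hnp, false_and, if_false, sub_zero]
    rw [Real.norm_eq_abs, abs_div, Nat.abs_cast]
    push_cast
    calc _ ≤ 5 * (7 / 4) ^ (k + 1 + 1) * Real.log (p : ℕ) / ((p : ℕ) : ℝ) ^ (k + 1 + 1) := by
          gcongr
      _ = 5 * (7 / 4) ^ 2 * (Real.log (p : ℕ) / ((p : ℕ) : ℝ) ^ 2) * (7 / 4 / (p : ℕ)) ^ k := by
          rw [div_pow _ ((p : ℕ) : ℝ) k, pow_succ, pow_succ, pow_succ _ (k + 1), pow_succ _ k]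
          ring
      _ ≤ 5 * (7 / 4) ^ 2 * (Real.log (p : ℕ) / ((p : ℕ) : ℝ) ^ 2) * (7 / 8) ^ k := by
          have : (7 / 4 / (p : ℕ) : ℝ) ≤ 7 / 8 := by
            rw [div_le_iff₀ (by positivity)]
            linarith
          gcongr ?_ * ?_ ^ k
      _ = _ := by ring

lemma IsVonMangoldtOf.lseriesSummable {S : Set ℕ} {ΛS : ℕ → ℝ}
    (hΛ : IsVonMangoldtOf S ΛS) (h1 : 1 ∈ S) {s : ℝ} (hs : 1 < s) :
    LSeriesSummable (fun n => (ΛS n : ℂ)) s := by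
  set P : ℕ → ℝ := fun n => if n.Prime ∧ n ∈ S then Real.log n else 0 with hP
  have hA : LSeriesSummable (fun n => ((ΛS n - P n : ℝ) : ℂ)) s := by
    refine LSeriesSummable.of_re_le_re (s := 1) (by simpa using hs.le) ?_
    refine Summable.of_norm_bounded (hΛ.summable_sub_prime_div h1).norm fun n => ?_
    rcases eq_or_ne n 0 with rfl | hn
    · simp
    · rw [LSeries.term_of_ne_zero hn, Complex.cpow_one, norm_div, Complex.norm_real,
        Complex.norm_natCast, norm_div, Real.norm_natCast]
  have hB : LSeriesSummable (fun n => ((P n : ℝ) : ℂ)) s := by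
    have hv := ArithmeticFunction.LSeriesSummable_vonMangoldt (s := s) (by simpa using hs)
    refine Summable.of_norm_bounded hv.norm fun n => LSeries.norm_term_le _ ?_
    simp only [hP, Complex.norm_real]
    split_ifs with h
    · rw [ArithmeticFunction.vonMangoldt_apply_prime h.1]
    · simp
  refine (hA.add hB).congr fun n => ?_
  simp [LSeries.term]

lemma LSeries_ofReal (f : ℕ → ℝ) {s : ℝ} (hs : s ≠ 0) :
    LSeries (fun n => (f n : ℂ)) s = ((∑' n : ℕ, f n * (n : ℝ) ^ (-s) : ℝ) : ℂ) := by
  rw [LSeries, Complex.ofReal_tsum]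
  refine tsum_congr fun n => ?_
  rcases eq_or_ne n 0 with rfl | hn
  · simp [Real.zero_rpow (neg_ne_zero.mpr hs)]
  · rw [LSeries.term_of_ne_zero hn, Complex.ofReal_mul, Complex.ofReal_cpow n.cast_nonneg,
      Complex.ofReal_neg, Complex.cpow_neg, Complex.ofReal_natCast, div_eq_mul_inv]

lemma LSeriesSummable.summable_real {f : ℕ → ℝ} {s : ℝ} (hs : s ≠ 0)
    (h : LSeriesSummable (fun n => (f n : ℂ)) s) :
    Summable fun n : ℕ => f n * (n : ℝ) ^ (-s) := by
  rw [← Complex.summable_ofReal]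
  refine Summable.congr h fun n => ?_
  rcases eq_or_ne n 0 with rfl | hn
  · simp [Real.zero_rpow (neg_ne_zero.mpr hs)]
  · rw [LSeries.term_of_ne_zero hn, Complex.ofReal_mul, Complex.ofReal_cpow n.cast_nonneg,
      Complex.ofReal_neg, Complex.cpow_neg, Complex.ofReal_natCast, div_eq_mul_inv]

lemma LSeries'_eq_tsum (S : Set ℕ) (s : ℝ) :
    LSeries' S s = ∑' n : ℕ, chiS S n * (n : ℝ) ^ (-s) :=
  tsum_congr fun n => by simp [chiS]

lemma abscissaOfAbsConv_chiS_le (S : Set ℕ) :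
    LSeries.abscissaOfAbsConv (fun n => (chiS S n : ℂ)) ≤ 1 :=
  LSeries.abscissaOfAbsConv_le_of_le_const ⟨1, fun n _ => by
    rw [Complex.norm_real, Real.norm_eq_abs, abs_of_nonneg (chiS_mem_Icc S n).1]
    exact (chiS_mem_Icc S n).2⟩

lemma LSeriesSummable_chiS (S : Set ℕ) {s : ℝ} (hs : 1 < s) :
    LSeriesSummable (fun n => (chiS S n : ℂ)) s :=
  LSeriesSummable_of_abscissaOfAbsConv_lt_re
    ((abscissaOfAbsConv_chiS_le S).trans_lt (by simpa using (by exact_mod_cast hs)))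

lemma LSeries'_pos {S : Set ℕ} (h1 : 1 ∈ S) {s : ℝ} (hs : 1 < s) : 0 < LSeries' S s := by
  rw [LSeries'_eq_tsum]
  have h := (LSeriesSummable_chiS S hs).summable_real (by linarith)
  refine h.tsum_pos (fun n => mul_nonneg (chiS_mem_Icc S n).1 (by positivity)) 1 ?_
  simp [chiS, h1]

/-- The logarithmic derivative of `L_S` is minus the Dirichlet series of `Λ_S`. -/
lemma IsVonMangoldtOf.deriv_div_LSeries' {S : Set ℕ} {ΛS : ℕ → ℝ}
    (hΛ : IsVonMangoldtOf S ΛS) (h1 : 1 ∈ S) {s : ℝ} (hs : 1 < s) :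
    deriv (LSeries' S) s / LSeries' S s = -∑' n : ℕ, ΛS n * (n : ℝ) ^ (-s) := by
  have habs : LSeries.abscissaOfAbsConv (fun n => (chiS S n : ℂ)) < (s : ℂ).re :=
    (abscissaOfAbsConv_chiS_le S).trans_lt (by simpa using (by exact_mod_cast hs))
  have hder := (LSeries_hasDerivAt habs).real_of_complex
  have hev : (fun x : ℝ => (LSeries (fun n => (chiS S n : ℂ)) x).re) =ᶠ[nhds s] LSeries' S := by
    filter_upwards [lt_mem_nhds hs] with x hx
    rw [LSeries_ofReal _ (by linarith), Complex.ofReal_re, LSeries'_eq_tsum]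
  have hd := (hder.congr_of_eventuallyEq hev.symm).deriv
  have hconv : LSeries (LSeries.logMul fun n => (chiS S n : ℂ)) s =
      LSeries (fun n => (chiS S n : ℂ)) s * LSeries (fun n => (ΛS n : ℂ)) s := by
    rw [← LSeries_convolution' (LSeriesSummable_chiS S hs) (hΛ.lseriesSummable h1 hs)]
    refine LSeries_congr (fun {n} hn => ?_) _
    have h := hΛ.2 n (Nat.one_le_iff_ne_zero.mpr hn)
    rw [LSeries.convolution_def]
    beta_reduce
    rw [Nat.sum_divisorsAntidiagonal'
      (f := fun x y => (chiS S x : ℂ) * (ΛS y : ℂ)), LSeries.logMul, ← Complex.natCast_log,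
      mul_comm]
    exact_mod_cast h
  have hpos := LSeries'_pos h1 hs
  rw [hd, hconv, LSeries_ofReal _ (by linarith), LSeries_ofReal _ (by linarith),
    ← LSeries'_eq_tsum, ← Complex.ofReal_mul, ← Complex.ofReal_neg, Complex.ofReal_re]
  field_simp

lemma tendsto_tsum_rpow_neg_sub_one_div :
    Tendsto (fun s : ℝ => ∑' n : ℕ, (1 : ℝ) * (n : ℝ) ^ (-s) - 1 / (s - 1))
      (nhdsWithin 1 (Set.Ioi 1)) (nhds Real.eulerMascheroniConstant) := by
  have h := (Complex.continuous_re.tendsto _).comp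
    ZetaAsymptotics.tendsto_riemannZeta_sub_one_div_nhds_right
  rw [Complex.ofReal_re] at h
  refine h.congr' ?_
  filter_upwards [self_mem_nhdsWithin] with s (hs : 1 < s)
  have hz : riemannZeta s = LSeries (fun _ => ((1 : ℝ) : ℂ)) s := by
    rw [← LSeries_one_eq_riemannZeta (by simpa using hs)]
    refine LSeries_congr (fun _ => by simp) _
  rw [Function.comp_apply, hz, LSeries_ofReal (fun _ => 1) (by linarith)]
  norm_cast

/-- If the multiplicative set `S` satisfies Condition B with density `δ` and exponent
`ρ`, then the series `∑_{n ≥ 1} (δ - Λ_S(n))/n` converges (its partial sums have a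
limit `L`) and `γ_S = -δγ + L`, where `γ` is the Euler–Mascheroni constant. -/
theorem eulerKronecker_eq_sum (S : Set ℕ) (δ ρ γS : ℝ) (ΛS : ℕ → ℝ)
    (hδ : 0 < δ) (hρ : 0 < ρ) (hS : IsMultiplicativeSet S) (hB : ConditionB S δ ρ)
    (hEK : IsEulerKronecker S δ γS) (hΛ : IsVonMangoldtOf S ΛS) :
    ∃ L : ℝ,
      Tendsto (fun N : ℕ => ∑ n ∈ Finset.Icc 1 N, (δ - ΛS n) / (n : ℝ)) atTop (nhds L) ∧
      γS = -δ * Real.eulerMascheroniConstant + L := by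
  have h1 : 1 ∈ S := hS.1
  obtain ⟨L₁, hL₁⟩ := hB.exists_tendsto_sum_primes hρ
  have hh := (summable_nat_add_iff 1).mpr (hΛ.summable_sub_prime_div h1)
  obtain ⟨L, hL⟩ : ∃ L : ℝ, Tendsto (fun N : ℕ => ∑ n ∈ Finset.range N,
      (δ - ΛS (n + 1)) / ((n : ℝ) + 1)) atTop (nhds L) := by
    refine ⟨_, (hL₁.sub hh.hasSum.tendsto_sum_nat).congr fun N => ?_⟩
    rw [← Finset.sum_sub_distrib]
    refine Finset.sum_congr rfl fun n _ => ?_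
    push_cast
    ring
  refine ⟨L, hL.congr fun N => ?_, ?_⟩
  · have h := Finset.sum_Ico_add' (fun n : ℕ => (δ - ΛS n) / (n : ℝ)) 0 N 1
    rw [← Finset.range_eq_Ico, zero_add, Finset.Ico_add_one_right_eq_Icc] at h
    simpa using h
  have hterm : ∀ ε : ℝ, ∀ n : ℕ, (δ - ΛS (n + 1)) / ((n : ℝ) + 1) * ((n : ℝ) + 1) ^ (-ε) =
      δ * (1 * ((n + 1 : ℕ) : ℝ) ^ (-(1 + ε))) -
        ΛS (n + 1) * ((n + 1 : ℕ) : ℝ) ^ (-(1 + ε)) := by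
    intro ε n
    have hn : (0 : ℝ) < (n : ℝ) + 1 := by positivity
    push_cast
    rw [neg_add, Real.rpow_add hn, Real.rpow_neg_one]
    ring
  have hsum1 : ∀ s : ℝ, 1 < s → Summable fun n : ℕ => (1 : ℝ) * (n : ℝ) ^ (-s) := by
    intro s hs
    simpa using Real.summable_nat_rpow.mpr (show -s < -1 by linarith)
  have hsumΛ : ∀ s : ℝ, 1 < s → Summable fun n : ℕ => ΛS n * (n : ℝ) ^ (-s) := fun s hs =>
    (hΛ.lseriesSummable h1 hs).summable_real (by linarith)
  have hHas : ∀ ε : ℝ, 0 < ε → HasSum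
      (fun n : ℕ => (δ - ΛS (n + 1)) / ((n : ℝ) + 1) * ((n : ℝ) + 1) ^ (-ε))
      (δ * (∑' n : ℕ, (1 : ℝ) * (n : ℝ) ^ (-(1 + ε))) -
        ∑' n : ℕ, ΛS n * (n : ℝ) ^ (-(1 + ε))) := by
    intro ε hε
    have hε' : -(1 + ε) ≠ 0 := by linarith
    have hA := (hasSum_nat_add_iff' 1).mpr (hsum1 (1 + ε) (by linarith)).hasSum
    have hB := (hasSum_nat_add_iff' 1).mpr (hsumΛ (1 + ε) (by linarith)).hasSum
    simp only [Finset.sum_range_one, Nat.cast_zero, Real.zero_rpow hε', mul_zero, sub_zero]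
      at hA hB
    simp only [hterm]
    exact (hA.mul_left δ).sub hB
  have hAbel := tendsto_tsum_mul_rpow_neg hL fun ε hε => (hHas ε hε).summable
  have hshift : Tendsto (fun s : ℝ => s - 1) (nhdsWithin 1 (Set.Ioi 1))
      (nhdsWithin 0 (Set.Ioi 0)) := by
    refine tendsto_nhdsWithin_of_tendsto_nhds_of_eventually_within _ ?_ ?_
    · have : Tendsto (fun s : ℝ => s - 1) (nhds 1) (nhds (1 - 1)) := tendsto_id.sub_const 1
      rw [sub_self] at this
      exact this.mono_left nhdsWithin_le_nhds
    · filter_upwards [self_mem_nhdsWithin] with s (hs : 1 < s)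
      exact sub_pos.mpr hs
  have hlim := ((tendsto_tsum_rpow_neg_sub_one_div.const_mul δ).add hEK).congr'
    (f₂ := fun s : ℝ => ∑' n : ℕ,
      (δ - ΛS (n + 1)) / ((n : ℝ) + 1) * ((n : ℝ) + 1) ^ (-(s - 1))) (by
    filter_upwards [self_mem_nhdsWithin] with s (hs : 1 < s)
    rw [(hHas (s - 1) (by linarith)).tsum_eq, hΛ.deriv_div_LSeries' h1 hs, add_sub_cancel]
    ring)
  have := tendsto_nhds_unique hlim (hAbel.comp hshift)
  linarith
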